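/- arXiv:2205.04210 — 2 statements merged into one kernel-verified Lean document; each statement's English description precedes it below -/
import Mathlib

section
/- Let L be a firewall rule list over d fields with n rules whose boxes are contained in [0, B - 1]^d. Then there exists a collection Q of at most (2n + 1)^d pairwise disjoint boxes whose union is [0, B - 1]^d such that the decision function of L is constant on each member of Q. -/
/-- A box in `ℕ^d`: a product of integer intervals (possibly empty). -/
def IsBox {d : ℕ} (s : Set (Fin d → ℕ)) : Prop :=
  ∃ a b : Fin d → ℕ, s = {x | ∀ i, a i ≤ x i ∧ x i ≤ b i}

/-- A firewall action: accept or deny. -/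
inductive FwAction : Type
  | accept : FwAction
  | deny : FwAction

/-- A firewall rule: a box predicate together with an action. -/
abbrev FwRule (d : ℕ) := Set (Fin d → ℕ) × FwAction

/-- The decision of a firewall rule list on a packet: the action of the first rule
whose box contains the packet, `deny` if no rule matches. -/
noncomputable def fwDecide {d : ℕ} : List (FwRule d) → (Fin d → ℕ) → FwAction
  | [], _ => FwAction.deny
  | (P, act) :: tl, x =>
      haveI := Classical.propDecidable (x ∈ P)
      if x ∈ P then act else fwDecide tl x

theorem Set.OrdConnected.exists_eq_Icc_of_nat {s : Set ℕ} (hs : s.OrdConnected)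
    (hne : s.Nonempty) (hb : BddAbove s) : ∃ a b, s = Set.Icc a b := by
  refine ⟨sInf s, sSup s, Set.Subset.antisymm ?_ ?_⟩
  · exact fun x hx => ⟨Nat.sInf_le hx, le_csSup hb hx⟩
  · exact hs.out (Nat.sInf_mem hne) (Nat.sSup_mem hne hb)

/-- The number of cut points of `C` that are at most `x`. -/
def cutLevel (C : Finset ℕ) (x : ℕ) : ℕ := (C.filter (· ≤ x)).card

theorem cutLevel_mono (C : Finset ℕ) : Monotone (cutLevel C) := fun _ _ h =>
  Finset.card_le_card <| Finset.monotone_filter_right C fun _ _ hc => hc.trans h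

theorem cutLevel_le_card (C : Finset ℕ) (x : ℕ) : cutLevel C x ≤ C.card :=
  Finset.card_filter_le _ _

theorem le_iff_le_of_cutLevel_eq {C : Finset ℕ} {x y : ℕ} (h : cutLevel C x = cutLevel C y)
    {c : ℕ} (hc : c ∈ C) : c ≤ x ↔ c ≤ y := by
  wlog hxy : x ≤ y generalizing x y
  · exact (this h.symm (le_of_not_ge hxy)).symm
  have hfilter : C.filter (· ≤ x) = C.filter (· ≤ y) :=
    Finset.eq_of_subset_of_card_le
      (Finset.monotone_filter_right C fun _ _ hc => hc.trans hxy) h.ge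
  simpa [hc] using Finset.ext_iff.mp hfilter c

/-- The decision of a rule list depends only on the position of each coordinate relative to at
most two cut points per rule. -/
theorem exists_cuts_fwDecide_eq {d : ℕ} (L : List (FwRule d)) (hbox : ∀ r ∈ L, IsBox r.1) :
    ∃ C : Fin d → Finset ℕ, (∀ i, (C i).card ≤ 2 * L.length) ∧
      ∀ x y : Fin d → ℕ, (∀ i, ∀ c ∈ C i, c ≤ x i ↔ c ≤ y i) →
        fwDecide L x = fwDecide L y := by
  induction L with
  | nil => exact ⟨fun _ => ∅, by simp, fun _ _ _ => rfl⟩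
  | cons r L ih =>
    obtain ⟨P, act⟩ := r
    obtain ⟨C, hcard, hC⟩ := ih fun r hr => hbox r (List.mem_cons_of_mem _ hr)
    obtain ⟨a, b, hP⟩ : IsBox P := hbox _ List.mem_cons_self
    refine ⟨fun i => insert (a i) (insert (b i + 1) (C i)), fun i => ?_, fun x y hxy => ?_⟩
    · have h₁ := Finset.card_insert_le (a i) (insert (b i + 1) (C i))
      have h₂ := Finset.card_insert_le (b i + 1) (C i)
      have h₃ := hcard i
      simp only [List.length_cons]
      omega
    · have hmem : x ∈ P ↔ y ∈ P := by
        subst hP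
        refine forall_congr' fun i => ?_
        have h₁ := hxy i (a i) (by simp)
        have h₂ := hxy i (b i + 1) (by simp)
        omega
      have htail : fwDecide L x = fwDecide L y :=
        hC x y fun i c hc => hxy i c (by simp [hc])
      by_cases hy : y ∈ P
      · simp [fwDecide, hmem.mpr hy, hy]
      · simp [fwDecide, mt hmem.mp hy, hy, htail]

/-- The grid cell of `[0, m]^d` in which coordinate `i` has level `g i` with respect to the cut
points `C i`. -/
def gridCell {d : ℕ} (C : Fin d → Finset ℕ) (m : ℕ) (g : Fin d → ℕ) : Set (Fin d → ℕ) :=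
  {x | ∀ i, x i ≤ m ∧ cutLevel (C i) (x i) = g i}

theorem isBox_gridCell {d : ℕ} {C : Fin d → Finset ℕ} {m : ℕ} {g : Fin d → ℕ}
    (hne : (gridCell C m g).Nonempty) : IsBox (gridCell C m g) := by
  obtain ⟨z, hz⟩ := hne
  have hIcc (i : Fin d) : ∃ a b, {t | t ≤ m ∧ cutLevel (C i) t = g i} = Set.Icc a b := by
    refine Set.OrdConnected.exists_eq_Icc_of_nat ⟨?_⟩ ⟨z i, hz i⟩ ⟨m, fun t ht => ht.1⟩
    rintro s ⟨-, hs⟩ t ⟨htm, ht⟩ u ⟨hsu, hut⟩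
    exact ⟨hut.trans htm,
      ((cutLevel_mono _ hut).trans_eq ht).antisymm (hs.symm.trans_le (cutLevel_mono _ hsu))⟩
  choose a b hab using hIcc
  exact ⟨a, b, Set.ext fun x => forall_congr' fun i => Set.ext_iff.mp (hab i) (x i)⟩

/-- A firewall rule list with `n` rules whose boxes lie in `[0, B-1]^d` admits a
partition of `[0, B-1]^d` into at most `(2n+1)^d` pairwise disjoint boxes on each of which the
decision function is constant. -/
theorem firewall_decision_tree (B d n : ℕ) (L : List (FwRule d))
    (hn : L.length = n)
    (hbox : ∀ r ∈ L, IsBox r.1)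
    (hsub : ∀ r ∈ L, r.1 ⊆ {x : Fin d → ℕ | ∀ i, x i ≤ B - 1}) :
    ∃ Q : Finset (Set (Fin d → ℕ)),
      Q.card ≤ (2 * n + 1) ^ d ∧
      (∀ q ∈ Q, IsBox q) ∧
      (Q : Set (Set (Fin d → ℕ))).PairwiseDisjoint id ∧
      ⋃₀ ↑Q = {x : Fin d → ℕ | ∀ i, x i ≤ B - 1} ∧
      ∀ q ∈ Q, ∀ x ∈ q, ∀ y ∈ q, fwDecide L x = fwDecide L y := by
  classical
  subst hn
  obtain ⟨C, hcard, hC⟩ := exists_cuts_fwDecide_eq L hbox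
  let cell (g : Fin d → Fin (2 * L.length + 1)) : Set (Fin d → ℕ) :=
    gridCell C (B - 1) fun i => g i
  have hQ {q : Set (Fin d → ℕ)}
      (hq : q ∈ (Finset.univ.image cell).filter Set.Nonempty) :
      ∃ g, cell g = q ∧ q.Nonempty := by
    simpa using hq
  refine ⟨(Finset.univ.image cell).filter Set.Nonempty, ?_, ?_, ?_, ?_, ?_⟩
  · calc _ ≤ (Finset.univ.image cell).card := Finset.card_filter_le _ _
      _ ≤ Fintype.card (Fin d → Fin (2 * L.length + 1)) := Finset.card_image_le
      _ = _ := by simp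
  · intro q hq
    obtain ⟨g, rfl, hne⟩ := hQ hq
    exact isBox_gridCell hne
  · intro q hq q' hq' hqq'
    obtain ⟨g, rfl, -⟩ := hQ hq
    obtain ⟨g', rfl, -⟩ := hQ hq'
    refine Set.disjoint_left.mpr fun x hx hx' => hqq' (congrArg cell ?_)
    exact funext fun i => Fin.ext ((hx i).2.symm.trans (hx' i).2)
  · refine Set.Subset.antisymm ?_ fun x hx => ?_
    · rintro x ⟨q, hq, hxq⟩ i
      obtain ⟨g, rfl, -⟩ := hQ hq
      exact (hxq i).1
    · let g (i : Fin d) : Fin (2 * L.length + 1) :=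
        ⟨cutLevel (C i) (x i), Nat.lt_succ_of_le ((cutLevel_le_card _ _).trans (hcard i))⟩
      have hxg : x ∈ cell g := fun i => ⟨hx i, rfl⟩
      exact ⟨cell g, Finset.mem_coe.mpr (Finset.mem_filter.mpr
        ⟨Finset.mem_image_of_mem _ (Finset.mem_univ g), x, hxg⟩), hxg⟩
  · intro q hq x hx y hy
    obtain ⟨g, rfl, -⟩ := hQ hq
    exact hC x y fun i c hc => le_iff_le_of_cutLevel_eq ((hx i).2.trans (hy i).2.symm) hc
end

section
/- Let L be a firewall rule list over d fields with n rules whose boxes are contained in [0, B - 1]^d. Then the accept set of L, i.e. the set of packets x ∈ [0, B - 1]^d on which L decides accept, is the union of a collection of at most (2n + 1)^d pairwise disjoint boxes. (Every firewall rule list of n rules can be rewritten as a whitelist of at most (2n + 1)^d accept rules with pairwise disjoint predicates, followed by a default deny.) -/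
/-- A bounded order-connected set of naturals is an interval, possibly empty. -/
theorem Set.OrdConnected.exists_eq_Icc_nat {s : Set ℕ} (hs : s.OrdConnected) {M : ℕ}
    (hM : ∀ t ∈ s, t ≤ M) : ∃ a b : ℕ, s = Set.Icc a b := by
  rcases s.eq_empty_or_nonempty with rfl | hne
  · exact ⟨1, 0, by simp⟩
  · have hbdd : BddAbove s := ⟨M, hM⟩
    refine ⟨sInf s, sSup s, Set.Subset.antisymm ?_ ?_⟩
    · exact fun t ht => ⟨Nat.sInf_le ht, le_csSup hbdd ht⟩
    · exact hs.out (Nat.sInf_mem hne) (Nat.sSup_mem hne hbdd)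

/-- A product of bounded order-connected sets of naturals is a box. -/
theorem isBox_of_ordConnected {d M : ℕ} (s : Fin d → Set ℕ) (hs : ∀ i, (s i).OrdConnected)
    (hM : ∀ i, ∀ t ∈ s i, t ≤ M) : IsBox {x : Fin d → ℕ | ∀ i, x i ∈ s i} := by
  choose a b hab using fun i => (hs i).exists_eq_Icc_nat (hM i)
  exact ⟨a, b, by simp only [hab, Set.mem_Icc]⟩

/-- Nested predicates with the same count on a list agree on its members. -/
theorem List.iff_of_countP_eq {α : Type*} {p q : α → Prop} [DecidablePred p] [DecidablePred q]
    {l : List α} (hpq : ∀ r, p r → q r)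
    (h : l.countP (fun r => p r) = l.countP (fun r => q r)) : ∀ r ∈ l, (p r ↔ q r) := by
  induction l with
  | nil => simp
  | cons c l ih =>
    have hle : l.countP (fun r => p r) ≤ l.countP (fun r => q r) :=
      List.countP_mono_left fun r _ => by simpa using hpq r
    have hc := hpq c
    simp only [List.countP_cons, decide_eq_true_eq] at h
    intro r hr
    rcases List.mem_cons.mp hr with rfl | hr
    · by_cases hp : p r <;> by_cases hq : q r <;> simp_all
    · refine ih ?_ r hr
      by_cases hp : p c <;> by_cases hq : q c <;> simp_all

/-- The number of cut points not exceeding `t`, where the interval `[a r, b r]`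
contributes the cut points `a r` and `b r + 1` for each `r ∈ l`. -/
def cutRank {α : Type*} (l : List α) (a b : α → ℕ) (t : ℕ) : ℕ :=
  l.countP (fun r => a r ≤ t) + l.countP (fun r => b r < t)

theorem cutRank_lt {α : Type*} (l : List α) (a b : α → ℕ) (t : ℕ) :
    cutRank l a b t < 2 * l.length + 1 := by
  have h₁ := List.countP_le_length (p := fun r => decide (a r ≤ t)) (l := l)
  have h₂ := List.countP_le_length (p := fun r => decide (b r < t)) (l := l)
  unfold cutRank
  omega

theorem countP_le_mono {α : Type*} (l : List α) (a : α → ℕ) :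
    Monotone fun t => l.countP (fun r => a r ≤ t) := fun s t hst =>
  List.countP_mono_left fun r _ => by simpa using fun h => le_trans h hst

theorem countP_lt_mono {α : Type*} (l : List α) (b : α → ℕ) :
    Monotone fun t => l.countP (fun r => b r < t) := fun s t hst =>
  List.countP_mono_left fun r _ => by simpa using fun h => lt_of_lt_of_le h hst

theorem cutRank_mono {α : Type*} (l : List α) (a b : α → ℕ) : Monotone (cutRank l a b) :=
  (countP_le_mono l a).add (countP_lt_mono l b)

/-- Points of equal cut rank lie in the same intervals. -/
theorem mem_Icc_iff_of_cutRank_eq {α : Type*} {l : List α} {a b : α → ℕ} {s t : ℕ}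
    (h : cutRank l a b s = cutRank l a b t) {r : α} (hr : r ∈ l) :
    (a r ≤ s ∧ s ≤ b r) ↔ (a r ≤ t ∧ t ≤ b r) := by
  wlog hst : s ≤ t generalizing s t
  · exact (this h.symm (le_of_not_ge hst)).symm
  have h₁ := countP_le_mono l a hst
  have h₂ := countP_lt_mono l b hst
  simp only at h₁ h₂
  unfold cutRank at h
  have e₁ := List.iff_of_countP_eq (p := fun r => a r ≤ s) (q := fun r => a r ≤ t) (l := l)
    (fun _ h => h.trans hst) (by omega) r hr
  have e₂ := List.iff_of_countP_eq (p := fun r => b r < s) (q := fun r => b r < t) (l := l)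
    (fun _ h => h.trans_le hst) (by omega) r hr
  omega

/-- Packets matched by the same rules get the same decision. -/
theorem fwDecide_congr {d : ℕ} {L : List (FwRule d)} {x y : Fin d → ℕ}
    (h : ∀ r ∈ L, (x ∈ r.1 ↔ y ∈ r.1)) : fwDecide L x = fwDecide L y := by
  induction L with
  | nil => rfl
  | cons r L ih =>
    have hr := h r List.mem_cons_self
    have hL := ih fun s hs => h s (List.mem_cons_of_mem r hs)
    by_cases hy : y ∈ r.1 <;> simp [fwDecide, hr, hy, hL]

/-- The accept set of an `n`-rule firewall over `d` fields in `[0, B-1]^d` is the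
union of at most `(2n+1)^d` pairwise disjoint boxes (whitelist form). -/
theorem firewall_whitelist (B d n : ℕ) (L : List (FwRule d))
    (hn : L.length = n)
    (hbox : ∀ r ∈ L, IsBox r.1)
    (hsub : ∀ r ∈ L, r.1 ⊆ {x : Fin d → ℕ | ∀ i, x i ≤ B - 1}) :
    ∃ Q : Finset (Set (Fin d → ℕ)),
      Q.card ≤ (2 * n + 1) ^ d ∧
      (∀ q ∈ Q, IsBox q) ∧
      (Q : Set (Set (Fin d → ℕ))).PairwiseDisjoint id ∧
      ⋃₀ ↑Q =
        {x : Fin d → ℕ | (∀ i, x i ≤ B - 1) ∧ fwDecide L x = FwAction.accept} := by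
  classical
  subst hn
  choose! a b hab using hbox
  let rank (i : Fin d) : ℕ → ℕ := cutRank L (fun r => a r i) (fun r => b r i)
  let cell (k : Fin d → Fin (2 * L.length + 1)) : Set (Fin d → ℕ) :=
    {x | ∀ i, x i ∈ {t | t ≤ B - 1 ∧ rank i t = k i}}
  let A : Set (Fin d → ℕ) := {x | (∀ i, x i ≤ B - 1) ∧ fwDecide L x = FwAction.accept}
  have decide_eq {x y : Fin d → ℕ} (h : ∀ i, rank i (x i) = rank i (y i)) :
      fwDecide L x = fwDecide L y := by
    refine fwDecide_congr fun r hr => ?_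
    rw [hab r hr]
    exact forall_congr' fun i => mem_Icc_iff_of_cutRank_eq (h i) hr
  refine ⟨(Finset.univ.image cell).filter (· ⊆ A), ?_, ?_, ?_, ?_⟩
  · calc _ ≤ (Finset.univ.image cell).card := Finset.card_filter_le _ _
      _ ≤ (Finset.univ : Finset (Fin d → Fin (2 * L.length + 1))).card := Finset.card_image_le
      _ = (2 * L.length + 1) ^ d := by simp
  · intro q hq
    obtain ⟨k, -, rfl⟩ := Finset.mem_image.mp (Finset.mem_filter.mp hq).1
    refine isBox_of_ordConnected (M := B - 1) _ (fun i => ⟨?_⟩) fun i t ht => ht.1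
    rintro s ⟨-, hs⟩ t ⟨htB, ht⟩ u ⟨hsu, hut⟩
    exact ⟨hut.trans htB, le_antisymm (ht ▸ cutRank_mono _ _ _ hut)
      (hs ▸ cutRank_mono _ _ _ hsu)⟩
  · intro q hq q' hq' hne
    obtain ⟨k, -, rfl⟩ := Finset.mem_image.mp (Finset.mem_filter.mp hq).1
    obtain ⟨k', -, rfl⟩ := Finset.mem_image.mp (Finset.mem_filter.mp hq').1
    refine Set.disjoint_left.mpr fun x hx hx' => hne (congrArg cell ?_)
    exact funext fun i => Fin.ext ((hx i).2.symm.trans (hx' i).2)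
  · refine Set.Subset.antisymm ?_ fun x hx => ?_
    · exact Set.sUnion_subset fun q hq => (Finset.mem_filter.mp hq).2
    · refine ⟨cell fun i => ⟨rank i (x i), cutRank_lt _ _ _ _⟩,
        Finset.mem_filter.mpr ⟨Finset.mem_image_of_mem _ (Finset.mem_univ _), fun y hy => ?_⟩,
        fun i => ⟨hx.1 i, rfl⟩⟩
      exact ⟨fun i => (hy i).1, (decide_eq fun i => (hy i).2).trans hx.2⟩
end
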